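/- (Random Simons' inequality.) Let (Ω, 𝓕, ℙ) be a probability space, let E be a nonempty set, let ε ∈ L⁰ with ε > 0 almost surely, and let (f_n)_{n∈ℕ} be a sequence of functions f_n : E → L⁰ such that |f_n(X)| ≤ ε almost surely for every n ∈ ℕ and every X ∈ E. Let S be a subset of E such that for every sequence (Y_n)_{n∈ℕ} of random variables with Y_n > 0 a.s. for all n and Σ_{n≥1} Y_n = 1 a.s., there exists Z ∈ S with ess sup_{X∈E} Σ_{n≥1} Y_n·f_n(X) = Σ_{n≥1} Y_n·f_n(Z) almost surely. Then ess sup_{X∈S} ( ess limsup_{n→∞} f_n(X) ) ≥ ess inf_{f ∈ co_{L⁰}(f_n)} ( ess sup_{X∈E} f(X) ) almost surely, where co_{L⁰}(f_n) is the set of all functions of the form X ↦ Σ_{i∈I} Y_i·f_{n_i}(X) with I finite, Y_i ∈ L⁰, Y_i ≥ 0 a.s., and Σ_{i∈I} Y_i = 1 a.s. -/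

import Mathlib

open MeasureTheory Filter

/-- `F` is the (a.s. finite, real-valued) essential supremum of the family `Φ ⊆ L⁰`:
it is measurable, an a.s. upper bound of `Φ`, and dominated a.s. by every other
measurable a.s. upper bound. -/
def IsEssSup {Ω : Type*} [MeasurableSpace Ω] (μ : Measure Ω)
    (Φ : Set (Ω → ℝ)) (F : Ω → ℝ) : Prop :=
  Measurable F ∧ (∀ Y ∈ Φ, ∀ᵐ ω ∂μ, Y ω ≤ F ω) ∧
    ∀ Y' : Ω → ℝ, Measurable Y' → (∀ Y ∈ Φ, ∀ᵐ ω ∂μ, Y ω ≤ Y' ω) →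
      ∀ᵐ ω ∂μ, F ω ≤ Y' ω

/-- `F` is the (a.s. finite, real-valued) essential infimum of the family `Φ ⊆ L⁰`. -/
def IsEssInf {Ω : Type*} [MeasurableSpace Ω] (μ : Measure Ω)
    (Φ : Set (Ω → ℝ)) (F : Ω → ℝ) : Prop :=
  Measurable F ∧ (∀ Y ∈ Φ, ∀ᵐ ω ∂μ, F ω ≤ Y ω) ∧
    ∀ Y' : Ω → ℝ, Measurable Y' → (∀ Y ∈ Φ, ∀ᵐ ω ∂μ, Y' ω ≤ Y ω) →
      ∀ᵐ ω ∂μ, Y' ω ≤ F ω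

/-- Convex weights on `ℕ` supported on `[n, ∞)` and charging `n`. -/
def tailWeights (n : ℕ) : Set (ℕ → ℝ) :=
  {y | (∀ i, 0 ≤ y i) ∧ (∀ i < n, y i = 0) ∧ 0 < y n ∧ HasSum y 1}

lemma tailWeights_nonempty (n : ℕ) : (tailWeights n).Nonempty := by
  refine ⟨Pi.single n 1, fun i => ?_, fun i hi => ?_, ?_, ?_⟩
  · by_cases h : i = n
    · subst h; simp
    · simp [h]
  · simp [hi.ne]
  · simp
  · exact hasSum_pi_single n (1 : ℝ)

lemma summable_mul_of_abs_le_one {y b : ℕ → ℝ} (hy : Summable y) (hb : ∀ i, |b i| ≤ 1) :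
    Summable fun i => y i * b i := by
  refine Summable.of_norm_bounded hy.abs fun i => ?_
  rw [norm_mul, Real.norm_eq_abs, Real.norm_eq_abs]
  exact mul_le_of_le_one_right (abs_nonneg _) (hb i)

lemma abs_tsum_mul_le {y b : ℕ → ℝ} (hy : Summable y) (hb : ∀ i, |b i| ≤ 1) :
    |∑' i, y i * b i| ≤ ∑' i, |y i| := by
  refine tsum_of_norm_bounded (f := fun i => y i * b i) hy.abs.hasSum fun i => ?_
  rw [norm_mul, Real.norm_eq_abs, Real.norm_eq_abs]
  exact mul_le_of_le_one_right (abs_nonneg _) (hb i)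

lemma tsum_add_smul_mul {y v b : ℕ → ℝ} (t : ℝ) (hy : Summable y) (hv : Summable v)
    (hb : ∀ i, |b i| ≤ 1) :
    ∑' i, (y + t • v) i * b i = ∑' i, y i * b i + t * ∑' i, v i * b i := by
  rw [← tsum_mul_left, ← (summable_mul_of_abs_le_one hy hb).tsum_add
    ((summable_mul_of_abs_le_one hv hb).mul_left t)]
  refine tsum_congr fun i => ?_
  simp only [Pi.add_apply, Pi.smul_apply, smul_eq_mul]
  ring

lemma hasSum_pow_half_succ : HasSum (fun k : ℕ => (1 / 2 : ℝ) ^ (k + 1)) 1 := by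
  simpa [pow_succ] using hasSum_geometric_two.mul_right (1 / 2 : ℝ)

/-- The dyadic average `∑ₖ 2⁻⁽ᵏ⁺¹⁾ gₙ₊ₖ` of the tail of a sequence of weights. -/
noncomputable def dyadicTail (g : ℕ → ℕ → ℝ) (n i : ℕ) : ℝ :=
  ∑' k, (1 / 2 : ℝ) ^ (k + 1) * g (n + k) i

lemma summable_dyadicTail_term {g : ℕ → ℕ → ℝ} (hg : ∀ n, g n ∈ tailWeights n) (n i : ℕ) :
    Summable fun k => (1 / 2 : ℝ) ^ (k + 1) * g (n + k) i :=
  summable_mul_of_abs_le_one hasSum_pow_half_succ.summable fun k => by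
    rw [abs_of_nonneg ((hg _).1 i)]
    exact le_hasSum (hg (n + k)).2.2.2 i fun j _ => (hg _).1 j

lemma dyadicTail_mem {g : ℕ → ℕ → ℝ} (hg : ∀ n, g n ∈ tailWeights n) (n : ℕ) :
    dyadicTail g n ∈ tailWeights n := by
  have h0 : ∀ i k, 0 ≤ (1 / 2 : ℝ) ^ (k + 1) * g (n + k) i := fun i k =>
    mul_nonneg (by positivity) ((hg _).1 i)
  refine ⟨fun i => tsum_nonneg (h0 i), fun i hi => ?_, ?_, ?_⟩
  · have : ∀ k, g (n + k) i = 0 := fun k => (hg _).2.1 i (by omega)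
    simp [dyadicTail, this]
  · refine (summable_dyadicTail_term hg n n).tsum_pos (h0 n) 0 ?_
    exact mul_pos (by positivity) (hg n).2.2.1
  · have hrow : ∀ k, HasSum (fun i => (1 / 2 : ℝ) ^ (k + 1) * g (n + k) i)
        ((1 / 2 : ℝ) ^ (k + 1)) := fun k => by
      simpa using (hg (n + k)).2.2.2.mul_left ((1 / 2 : ℝ) ^ (k + 1))
    have hs : Summable fun p : ℕ × ℕ => (1 / 2 : ℝ) ^ (p.1 + 1) * g (n + p.1) p.2 := by
      rw [summable_prod_of_nonneg fun p => h0 p.2 p.1]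
      refine ⟨fun k => (hrow k).summable, ?_⟩
      simp_rw [(hrow _).tsum_eq]
      exact hasSum_pow_half_succ.summable
    have h1 : HasSum (fun p : ℕ × ℕ => (1 / 2 : ℝ) ^ (p.1 + 1) * g (n + p.1) p.2) 1 :=
      hs.hasSum_iff.2 ((hs.hasSum.prod_fiberwise hrow).unique hasSum_pow_half_succ)
    have h2 := (Equiv.prodComm ℕ ℕ).hasSum_iff.2 h1
    exact h2.prod_fiberwise fun i => (summable_dyadicTail_term hg n i).hasSum

lemma dyadicTail_succ {g : ℕ → ℕ → ℝ} (hg : ∀ n, g n ∈ tailWeights n) (n : ℕ) :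
    dyadicTail g n = (1 / 2 : ℝ) • g n + (1 / 2 : ℝ) • dyadicTail g (n + 1) := by
  funext i
  simp only [dyadicTail, Pi.add_apply, Pi.smul_apply, smul_eq_mul]
  rw [(summable_dyadicTail_term hg n i).tsum_eq_zero_add, ← tsum_mul_left]
  congr 1
  · simp
  · refine tsum_congr fun k => ?_
    rw [show n + (k + 1) = n + 1 + k by ring]
    ring

lemma dyadicTail_zero_pos {g : ℕ → ℕ → ℝ} (hg : ∀ n, g n ∈ tailWeights n) (i : ℕ) :
    0 < dyadicTail g 0 i := by
  refine (summable_dyadicTail_term hg 0 i).tsum_pos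
    (fun k => mul_nonneg (by positivity) ((hg _).1 i)) i (mul_pos (by positivity) ?_)
  simpa using (hg i).2.2.1

/-- Greedy choice: weights `gₙ` on `[n, ∞)` such that each `hₙ + 2⁻ⁿ gₙ`, where
`hₙ = ∑_{i < n} 2⁻⁽ⁱ⁺¹⁾ gᵢ`, minimizes `p` up to `δ n`. -/
lemma exists_greedy_weights (p : (ℕ → ℝ) → ℝ)
    (hp : ∀ y, Summable y → -∑' i, |y i| ≤ p y) (δ : ℕ → ℝ) (hδ : ∀ n, 0 < δ n) :
    ∃ g h : ℕ → ℕ → ℝ, (∀ n, g n ∈ tailWeights n) ∧ h 0 = 0 ∧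
      (∀ n, h (n + 1) = h n + ((1 / 2 : ℝ) ^ (n + 1)) • g n) ∧ (∀ n, Summable (h n)) ∧
      ∀ n, ∀ v ∈ tailWeights n,
        p (h n + ((1 / 2 : ℝ) ^ n) • g n) ≤ p (h n + ((1 / 2 : ℝ) ^ n) • v) + δ n := by
  have key : ∀ (n : ℕ) (y : ℕ → ℝ), ∃ g ∈ tailWeights n, Summable y → ∀ v ∈ tailWeights n,
      p (y + ((1 / 2 : ℝ) ^ n) • g) ≤ p (y + ((1 / 2 : ℝ) ^ n) • v) + δ n := by
    intro n y
    by_cases hy : Summable y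
    swap
    · obtain ⟨g, hg⟩ := tailWeights_nonempty n
      exact ⟨g, hg, fun h => absurd h hy⟩
    set V := (fun v => p (y + ((1 / 2 : ℝ) ^ n) • v)) '' tailWeights n
    have hne : V.Nonempty := (tailWeights_nonempty n).image _
    have hbdd : BddBelow V := by
      refine ⟨-(∑' i, |y i| + (1 / 2 : ℝ) ^ n), ?_⟩
      rintro _ ⟨v, hv, rfl⟩
      have hvs := hv.2.2.2.mul_left ((1 / 2 : ℝ) ^ n)
      have hsum : Summable (y + ((1 / 2 : ℝ) ^ n) • v) := hy.add hvs.summable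
      refine le_trans (neg_le_neg ?_) (hp _ hsum)
      have := hy.abs.hasSum.add hvs
      rw [mul_one] at this
      refine hasSum_le (fun i => ?_) hsum.abs.hasSum this
      refine (abs_add_le _ _).trans_eq ?_
      rw [Pi.smul_apply, smul_eq_mul, abs_of_nonneg (mul_nonneg (by positivity) (hv.1 i))]
    obtain ⟨_, ⟨g, hg, rfl⟩, hlt⟩ := exists_lt_of_csInf_lt hne (lt_add_of_pos_right (sInf V) (hδ n))
    refine ⟨g, hg, fun _ v hv => hlt.le.trans ?_⟩
    gcongr
    exact csInf_le hbdd ⟨v, hv, rfl⟩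
  choose G hG hmin using key
  let h : ℕ → ℕ → ℝ := fun n =>
    Nat.rec 0 (fun n y => y + ((1 / 2 : ℝ) ^ (n + 1)) • G n y) n
  have hs : ∀ n, Summable (h n) := by
    intro n
    induction n with
    | zero => exact summable_zero
    | succ n ih => exact ih.add ((hG n (h n)).2.2.2.summable.mul_left _)
  exact ⟨fun n => G n (h n), h, fun n => hG n _, rfl, fun n => rfl, hs,
    fun n => hmin n _ (hs n)⟩

/-- Simons' inequality for bounded real functions, with the infimum taken over strictly positive
convex series. -/
lemma simons_inequality_of_pos_weights {E : Type*} [Nonempty E] (a : ℕ → E → ℝ)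
    (ha : ∀ i x, |a i x| ≤ 1) (S : Set E)
    (hS : ∀ y : ℕ → ℝ, (∀ i, 0 < y i) → HasSum y 1 →
      ∃ z ∈ S, ∀ x, ∑' i, y i * a i x ≤ ∑' i, y i * a i z)
    {c c' : ℝ} (hc : ∀ y : ℕ → ℝ, (∀ i, 0 < y i) → HasSum y 1 → ∃ x, c ≤ ∑' i, y i * a i x)
    (hcc' : c' < c) : ∃ z ∈ S, ∃ᶠ i in atTop, c' ≤ a i z := by
  set L : (ℕ → ℝ) → E → ℝ := fun y x => ∑' i, y i * a i x with hL
  set p : (ℕ → ℝ) → ℝ := fun y => ⨆ x, L y x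
  set η := (c - c') / 2 with hη
  have hηpos : 0 < η := by linarith
  have hLp : ∀ y x, Summable y → L y x ≤ p y := fun y x hy =>
    le_ciSup (f := L y) ⟨∑' i, |y i|, by
      rintro _ ⟨x, rfl⟩
      exact (abs_le.1 (abs_tsum_mul_le hy fun i => ha i x)).2⟩ x
  obtain ⟨g, h, hg, h0, hsucc, hs, hmin⟩ := exists_greedy_weights p
    (fun y hy => by
      obtain ⟨x⟩ := ‹Nonempty E›
      exact (abs_le.1 (abs_tsum_mul_le hy fun i => ha i x)).1.trans (hLp y x hy))
    (fun n => η * (1 / 2) ^ n * (1 / 2) ^ (n + 1)) (fun n => by positivity)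
  have hH : ∀ n, h n + ((1 / 2 : ℝ) ^ n) • dyadicTail g n = dyadicTail g 0 := by
    intro n
    induction n with
    | zero => simp [h0]
    | succ n ih =>
      rw [← ih, hsucc, dyadicTail_succ hg n]
      module
  have hHpos := dyadicTail_zero_pos hg
  have hHsum := (dyadicTail_mem hg 0).2.2.2
  obtain ⟨z, hzS, hz⟩ := hS _ hHpos hHsum
  obtain ⟨x, hx⟩ := hc _ hHpos hHsum
  set P := L (dyadicTail g 0) z with hP
  have hcP : c ≤ P := hx.trans (hz x)
  have hstep : ∀ n, 2 * L (h (n + 1)) z - L (h n) z ≤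
      P + η * (1 / 2) ^ n * (1 / 2) ^ (n + 1) := by
    intro n
    have hgs := (hg n).2.2.2.summable
    have h1 := hLp (h n + ((1 / 2 : ℝ) ^ n) • g n) z ((hs n).add (hgs.mul_left _))
    have h2 := hmin n _ (dyadicTail_mem hg n)
    rw [hH] at h2
    have h3 : p (dyadicTail g 0) ≤ P := ciSup_le hz
    have h4 : L (h n + ((1 / 2 : ℝ) ^ n) • g n) z = L (h n) z + (1 / 2) ^ n * L (g n) z :=
      tsum_add_smul_mul _ (hs n) hgs fun i => ha i z
    have h5 : L (h (n + 1)) z = L (h n) z + (1 / 2) ^ (n + 1) * L (g n) z := by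
      rw [hsucc]
      exact tsum_add_smul_mul _ (hs n) hgs fun i => ha i z
    rw [h5, pow_succ]
    rw [pow_succ] at h2
    linarith
  have hbound : ∀ n, L (h n) z ≤ (1 - (1 / 2) ^ n) * P + η * (1 / 2) ^ n * (1 - (1 / 2) ^ n) := by
    intro n
    induction n with
    | zero => simp [h0, hL]
    | succ n ih =>
      have := hstep n
      rw [pow_succ] at this ⊢
      nlinarith
  have htail : ∀ n, c - η ≤ L (dyadicTail g n) z := by
    intro n
    have h1 : P = L (h n) z + (1 / 2) ^ n * L (dyadicTail g n) z := by
      rw [hP, ← hH n]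
      exact tsum_add_smul_mul _ (hs n) (dyadicTail_mem hg n).2.2.2.summable fun i => ha i z
    have h2 := hbound n
    have hpos : (0 : ℝ) < (1 / 2) ^ n := by positivity
    have h3 : (1 / 2 : ℝ) ^ n * (P - η * (1 - (1 / 2) ^ n)) ≤
        (1 / 2) ^ n * L (dyadicTail g n) z := by linarith
    have h4 := le_of_mul_le_mul_left h3 hpos
    nlinarith
  refine ⟨z, hzS, frequently_atTop.2 fun n => ?_⟩
  by_contra! hcon
  obtain ⟨hT0, hTz, -, hT1⟩ := dyadicTail_mem hg n
  have : L (dyadicTail g n) z ≤ 1 * c' := by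
    refine hasSum_le (fun i => ?_)
      (summable_mul_of_abs_le_one hT1.summable fun i => ha i z).hasSum (hT1.mul_right c')
    rcases lt_or_ge i n with hi | hi
    · simp [hTz i hi]
    · exact mul_le_mul_of_nonneg_left (hcon i hi).le (hT0 i)
  linarith [htail n]

lemma tsum_mul_integral_eq {Ω : Type*} [MeasurableSpace Ω] {ν : Measure Ω} [IsFiniteMeasure ν]
    {φ : ℕ → Ω → ℝ} (hφ : ∀ i, Measurable (φ i)) (hb : ∀ i, ∀ᵐ ω ∂ν, |φ i ω| ≤ 1)
    {y : ℕ → ℝ} (hy : Summable y) :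
    Integrable (fun ω => ∑' i, y i * φ i ω) ν ∧
      ∑' i, y i * ∫ ω, φ i ω ∂ν = ∫ ω, ∑' i, y i * φ i ω ∂ν := by
  have hint : ∀ i, Integrable (φ i) ν := fun i =>
    .of_bound (hφ i).aestronglyMeasurable 1 (hb i)
  have hall := ae_all_iff.2 hb
  have hae : ∀ᵐ ω ∂ν, HasSum (fun i => y i * φ i ω) (∑' i, y i * φ i ω) := by
    filter_upwards [hall] with ω hω
    exact (summable_mul_of_abs_le_one hy hω).hasSum
  have hmeas : Measurable fun ω => ∑' i, y i * φ i ω :=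
    Measurable.tsum fun i => (hφ i).const_mul (y i)
  refine ⟨.of_bound hmeas.aestronglyMeasurable (∑' i, |y i|) ?_, ?_⟩
  · filter_upwards [hall] with ω hω
    exact abs_tsum_mul_le hy hω
  · have h := hasSum_integral_of_dominated_convergence (μ := ν) (F := fun i ω => y i * φ i ω)
      (f := fun ω => ∑' i, y i * φ i ω) (fun i _ => |y i|)
      (fun i => ((hφ i).const_mul (y i)).aestronglyMeasurable)
      (fun i => (hb i).mono fun ω hω => by
        rw [norm_mul, Real.norm_eq_abs, Real.norm_eq_abs]
        exact mul_le_of_le_one_right (abs_nonneg _) hω)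
      (.of_forall fun _ => hy.abs) (integrable_const _) hae
    simp_rw [integral_const_mul] at h
    exact h.tsum_eq

/-- A form of the reverse Fatou lemma: integrals that exceed `c` infinitely often force the integral
of every majorant of the limsup to be at least `c`. -/
lemma le_integral_of_frequently_le {Ω : Type*} [MeasurableSpace Ω] {ν : Measure Ω}
    [IsFiniteMeasure ν] {φ : ℕ → Ω → ℝ} (hφ : ∀ i, Measurable (φ i))
    (hb : ∀ i, ∀ᵐ ω ∂ν, |φ i ω| ≤ 1) {ψ : Ω → ℝ} (hψ : Integrable ψ ν)
    (hlim : ∀ᵐ ω ∂ν, ∀ b > ψ ω, ∀ᶠ i in atTop, φ i ω < b) {c : ℝ}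
    (hc : ∃ᶠ i in atTop, c ≤ ∫ ω, φ i ω ∂ν) : c ≤ ∫ ω, ψ ω ∂ν := by
  have hint : ∀ i, Integrable (φ i) ν := fun i =>
    .of_bound (hφ i).aestronglyMeasurable 1 (hb i)
  have htend : Tendsto (fun i => ∫ ω, max (φ i ω) (ψ ω) ∂ν) atTop (nhds (∫ ω, ψ ω ∂ν)) := by
    refine tendsto_integral_of_dominated_convergence (fun ω => 1 + |ψ ω|)
      (fun i => ((hint i).sup hψ).aestronglyMeasurable) ((integrable_const 1).add hψ.abs)
      (fun i => ?_) ?_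
    · filter_upwards [hb i] with ω hω
      rw [Real.norm_eq_abs]
      refine abs_max_le_max_abs_abs.trans (max_le ?_ ?_)
      · linarith [abs_nonneg (ψ ω)]
      · linarith
    · filter_upwards [hlim] with ω hω
      refine tendsto_order.2 ⟨fun b hb => .of_forall fun i => hb.trans_le (le_max_right _ _),
        fun b hb => (hω b hb).mono fun i hi => max_lt hi hb⟩
  refine ge_of_tendsto_of_frequently htend (hc.mono fun i hi => hi.trans ?_)
  exact integral_mono (hint i) ((hint i).sup hψ) fun ω => le_max_left _ _

/-- Random Simons' inequality: if the functions `fₙ : E → L⁰` take their values in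
the ball of random radius `ε`, and every strictly positive random convex series
`Σ Yₙ fₙ` attains its essential supremum over `E` at a point of `S`, then
`ess sup_{X∈S} ess limsup fₙ(X) ≥ ess inf_{f ∈ co_{L⁰}(fₙ)} ess sup_{X∈E} f(X)` a.s.
(For a sequence in `L⁰`, the essential limsup coincides a.s. with the pointwise
limsup, which is used here.) -/
theorem random_simons_inequality {Ω : Type*} [MeasurableSpace Ω]
    (μ : Measure Ω) [IsProbabilityMeasure μ] {E : Type*} [Nonempty E]
    (ε : Ω → ℝ) (hεmeas : Measurable ε) (hεpos : ∀ᵐ ω ∂μ, 0 < ε ω)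
    (f : ℕ → E → Ω → ℝ) (hfmeas : ∀ n X, Measurable (f n X))
    (hfball : ∀ n X, ∀ᵐ ω ∂μ, |f n X ω| ≤ ε ω)
    (S : Set E)
    (hS : ∀ Y : ℕ → Ω → ℝ, (∀ n, Measurable (Y n)) →
      (∀ n, ∀ᵐ ω ∂μ, 0 < Y n ω) → (∀ᵐ ω ∂μ, (∑' n, Y n ω) = 1) →
      ∃ Z ∈ S, IsEssSup μ {h | ∃ X : E, h = fun ω => ∑' n, Y n ω * f n X ω}
        (fun ω => ∑' n, Y n ω * f n Z ω))
    (C : Set (E → Ω → ℝ))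
    (hC : C = {g | ∃ (I : Finset ℕ) (Y : ℕ → Ω → ℝ),
      (∀ i ∈ I, Measurable (Y i)) ∧ (∀ i ∈ I, ∀ᵐ ω ∂μ, 0 ≤ Y i ω) ∧
      (∀ᵐ ω ∂μ, (∑ i ∈ I, Y i ω) = 1) ∧
      g = fun X ω => ∑ i ∈ I, Y i ω * f i X ω})
    (lhs : Ω → ℝ)
    (hlhs : IsEssSup μ
      {h | ∃ X ∈ S, h = fun ω => limsup (fun n => f n X ω) atTop} lhs)
    (supE : (E → Ω → ℝ) → Ω → ℝ)
    (hsupE : ∀ g ∈ C, IsEssSup μ {h | ∃ X : E, h = g X} (supE g))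
    (rhs : Ω → ℝ)
    (hrhs : IsEssInf μ {h | ∃ g ∈ C, h = supE g} rhs) :
    ∀ᵐ ω ∂μ, rhs ω ≤ lhs ω := by
  have hε_all : ∀ X, ∀ᵐ ω ∂μ, ∀ n, |f n X ω| ≤ ε ω := fun X => ae_all_iff.2 fun n => hfball n X
  have hattain : ∀ y : ℕ → ℝ, (∀ i, 0 < y i) → HasSum y 1 → ∃ Z ∈ S, ∀ X, ∀ᵐ ω ∂μ,
      ∑' n, y n * f n X ω ≤ ∑' n, y n * f n Z ω := by
    intro y hy hy1
    obtain ⟨Z, hZS, hZ⟩ := hS (fun n _ => y n) (fun n => measurable_const)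
      (fun n => .of_forall fun _ => hy n) (.of_forall fun _ => hy1.tsum_eq)
    exact ⟨Z, hZS, fun X => hZ.2.1 _ ⟨X, rfl⟩⟩
  have hε_limsup : ∀ X, ∀ᵐ ω ∂μ, |limsup (fun n => f n X ω) atTop| ≤ ε ω := by
    intro X
    filter_upwards [hε_all X] with ω hω
    have hle : IsBoundedUnder (· ≤ ·) atTop fun n => f n X ω :=
      isBoundedUnder_of ⟨ε ω, fun n => (abs_le.1 (hω n)).2⟩
    have hge : IsBoundedUnder (· ≥ ·) atTop fun n => f n X ω :=
      isBoundedUnder_of ⟨-ε ω, fun n => (abs_le.1 (hω n)).1⟩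
    exact abs_le.2 ⟨le_limsup_of_frequently_le (Frequently.of_forall fun n => (abs_le.1 (hω n)).1) hle,
      limsup_le_of_le hge.isCoboundedUnder_le (.of_forall fun n => (abs_le.1 (hω n)).2)⟩
  have hlhs_abs : ∀ᵐ ω ∂μ, |lhs ω| ≤ ε ω := by
    obtain ⟨Z, hZS, -⟩ := hattain _ (fun i => by positivity) hasSum_pow_half_succ
    have hupper := hlhs.2.2 ε hεmeas (by
      rintro _ ⟨X, -, rfl⟩
      exact (hε_limsup X).mono fun ω h => (abs_le.1 h).2)
    filter_upwards [hupper, hε_limsup Z, hlhs.2.1 _ ⟨Z, hZS, rfl⟩] with ω h1 h2 h3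
    exact abs_le.2 ⟨(abs_le.1 h2).1.trans h3, h1⟩
  have hCmem : ∀ (I : Finset ℕ) (w : ℕ → ℝ), (∀ i, 0 ≤ w i) → ∑ i ∈ I, w i = 1 →
      (fun X ω => ∑ i ∈ I, w i * f i X ω) ∈ C := by
    intro I w hw hw1
    rw [hC]
    exact ⟨I, fun i _ => w i, fun i _ => measurable_const, fun i _ => .of_forall fun _ => hw i,
      .of_forall fun _ => hw1, rfl⟩
  have hC_abs : ∀ g ∈ C, ∀ X, ∀ᵐ ω ∂μ, |g X ω| ≤ ε ω := by
    intro g hg X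
    rw [hC] at hg
    obtain ⟨I, Y, -, hY0, hY1, rfl⟩ := hg
    filter_upwards [hε_all X, hY1, (ae_ball_iff I.countable_toSet).2 hY0] with ω hω h1 h0
    calc |∑ i ∈ I, Y i ω * f i X ω| ≤ ∑ i ∈ I, |Y i ω * f i X ω| := Finset.abs_sum_le_sum_abs _ _
      _ ≤ ∑ i ∈ I, Y i ω * ε ω := Finset.sum_le_sum fun i hi => by
          rw [abs_mul, abs_of_nonneg (h0 i hi)]
          exact mul_le_mul_of_nonneg_left (hω i) (h0 i hi)
      _ = ε ω := by rw [← Finset.sum_mul, h1, one_mul]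
  have hrhs_abs : ∀ᵐ ω ∂μ, |rhs ω| ≤ ε ω := by
    have hlower := hrhs.2.2 (fun ω => -ε ω) hεmeas.neg (by
      rintro _ ⟨g, hg, rfl⟩
      obtain ⟨X⟩ := ‹Nonempty E›
      filter_upwards [hC_abs g hg X, (hsupE g hg).2.1 _ ⟨X, rfl⟩] with ω h1 h2
      exact (abs_le.1 h1).1.trans h2)
    have hg := hCmem {0} (fun _ => 1) (fun _ => zero_le_one) (by simp)
    have hupper := (hsupE _ hg).2.2 ε hεmeas (by
      rintro _ ⟨X, rfl⟩
      exact (hC_abs _ hg X).mono fun ω h => (abs_le.1 h).2)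
    filter_upwards [hlower, hupper, hrhs.2.1 _ ⟨_, hg, rfl⟩] with ω h1 h2 h3
    exact abs_le.2 ⟨h1, h3.trans h2⟩
  have hrhs_le : ∀ y : ℕ → ℝ, (∀ i, 0 < y i) → HasSum y 1 → ∀ Z, (∀ X, ∀ᵐ ω ∂μ,
      ∑' n, y n * f n X ω ≤ ∑' n, y n * f n Z ω) →
      ∀ᵐ ω ∂μ, rhs ω ≤ ∑' n, y n * f n Z ω := by
    intro y hy hy1 Z hZ
    set r : ℕ → ℝ := fun N => 1 - ∑ i ∈ Finset.range N, y i with hr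
    have hr0 : ∀ N, 0 ≤ r N := fun N =>
      sub_nonneg.2 (sum_le_hasSum _ (fun i _ => (hy i).le) hy1)
    have hrlim : Tendsto r atTop (nhds 0) := by
      simpa using hy1.tendsto_sum_nat.const_sub 1
    have hZmeas : Measurable fun ω => ∑' n, y n * f n Z ω :=
      Measurable.tsum fun n => (hfmeas n Z).const_mul (y n)
    have hN : ∀ N, ∀ᵐ ω ∂μ, rhs ω ≤ ∑' n, y n * f n Z ω + 2 * r N * ε ω := by
      intro N
      set w : ℕ → ℝ := fun i => if i < N then y i else r N with hw
      have hwlt : ∀ i ∈ Finset.range N, w i = y i := fun i hi => if_pos (Finset.mem_range.1 hi)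
      have hwN : w N = r N := if_neg (lt_irrefl N)
      have hg := hCmem (Finset.range (N + 1)) w
        (fun i => by
          simp only [hw]
          split_ifs
          exacts [(hy i).le, hr0 N])
        (by rw [Finset.sum_range_succ, Finset.sum_congr rfl hwlt, hwN, hr]; ring)
      have hsup := (hsupE _ hg).2.2 (fun ω => ∑' n, y n * f n Z ω + 2 * r N * ε ω)
        (hZmeas.add (hεmeas.const_mul _)) (by
          rintro _ ⟨X, rfl⟩
          filter_upwards [hε_all X, hZ X] with ω h1 h2
          have hsplit : ∑ i ∈ Finset.range (N + 1), w i * f i X ω =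
              ∑ i ∈ Finset.range N, y i * f i X ω + r N * f N X ω := by
            rw [Finset.sum_range_succ, hwN]
            congr 1
            exact Finset.sum_congr rfl fun i hi => by rw [hwlt i hi]
          have hle : ∑ i ∈ Finset.range N, y i * (f i X ω + ε ω) ≤
              ∑' i, y i * f i X ω + 1 * ε ω := by
            have hs : Summable fun i => y i * f i X ω := by
              refine Summable.of_norm_bounded (hy1.summable.mul_right (ε ω)) fun i => ?_
              rw [norm_mul, Real.norm_of_nonneg (hy i).le]
              exact mul_le_mul_of_nonneg_left (h1 i) (hy i).le
            have hsum := hs.hasSum.add (hy1.mul_right (ε ω))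
            simp_rw [← mul_add] at hsum
            exact sum_le_hasSum _ (fun i _ => mul_nonneg (hy i).le
              (by linarith [(abs_le.1 (h1 i)).1])) hsum
          simp_rw [mul_add, Finset.sum_add_distrib, ← Finset.sum_mul] at hle
          have hrN := mul_le_mul_of_nonneg_left (abs_le.1 (h1 N)).2 (hr0 N)
          have hrε : r N * ε ω = 1 * ε ω - (∑ i ∈ Finset.range N, y i) * ε ω := by
            rw [hr, sub_mul]
          rw [hsplit]
          linarith)
      filter_upwards [hsup, hrhs.2.1 _ ⟨_, hg, rfl⟩] with ω h1 h2
      exact h2.trans h1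
    filter_upwards [ae_all_iff.2 hN] with ω hω
    refine ge_of_tendsto' (x := atTop) ?_ hω
    simpa using ((hrlim.const_mul 2).mul_const (ε ω)).const_add (∑' n, y n * f n Z ω)
  set A : Set Ω := {ω | lhs ω < rhs ω} with hA
  have hAmeas : MeasurableSet A := measurableSet_lt hlhs.1 hrhs.1
  set ν := μ.restrict A with hν
  have hac : ∀ {q : Ω → Prop}, (∀ᵐ ω ∂μ, q ω) → ∀ᵐ ω ∂ν, q ω := ae_restrict_of_ae
  have hν_prob : ν.real Set.univ ≤ 1 := by
    rw [hν, measureReal_restrict_apply_univ]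
    exact measureReal_le_one
  have hdiv_abs : ∀ {u : Ω → ℝ}, (∀ᵐ ω ∂μ, |u ω| ≤ ε ω) → ∀ᵐ ω ∂ν, |u ω / ε ω| ≤ 1 := by
    intro u hu
    filter_upwards [hac hu, hac hεpos] with ω h1 h2
    rw [abs_div, abs_of_pos h2]
    exact (div_le_one h2).2 h1
  have hdiv_int : ∀ {u : Ω → ℝ}, Measurable u → (∀ᵐ ω ∂μ, |u ω| ≤ ε ω) →
      Integrable (fun ω => u ω / ε ω) ν := fun hm hu =>
    .of_bound (hm.div hεmeas).aestronglyMeasurable 1 (hdiv_abs hu)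
  have hdiv_mono : ∀ {u v : Ω → ℝ}, Integrable (fun ω => u ω / ε ω) ν →
      Integrable (fun ω => v ω / ε ω) ν → (∀ᵐ ω ∂μ, u ω ≤ v ω) →
      ∫ ω, u ω / ε ω ∂ν ≤ ∫ ω, v ω / ε ω ∂ν := by
    intro u v hu hv huv
    refine integral_mono_ae hu hv ?_
    filter_upwards [hac huv, hac hεpos] with ω h1 h2
    exact div_le_div_of_nonneg_right h1 h2.le
  set a : ℕ → E → ℝ := fun n X => ∫ ω, f n X ω / ε ω ∂ν
  have ha_abs : ∀ n X, |a n X| ≤ 1 := by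
    intro n X
    have := norm_integral_le_of_norm_le_const (μ := ν) (C := 1)
      (f := fun ω => f n X ω / ε ω) (hdiv_abs (hfball n X))
    rw [one_mul] at this
    exact this.trans hν_prob
  have hseries : ∀ (y : ℕ → ℝ), HasSum y 1 → ∀ X,
      Integrable (fun ω => (∑' n, y n * f n X ω) / ε ω) ν ∧
      ∑' n, y n * a n X = ∫ ω, (∑' n, y n * f n X ω) / ε ω ∂ν := by
    intro y hy1 X
    have := tsum_mul_integral_eq (ν := ν) (fun n => (hfmeas n X).div hεmeas)
      (fun n => hdiv_abs (hfball n X)) hy1.summable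
    simpa only [Pi.div_apply, ← mul_div_assoc, tsum_div_const] using this
  have hlhs_int := hdiv_int hlhs.1 hlhs_abs
  have hrhs_int := hdiv_int hrhs.1 hrhs_abs
  have hint_le : ∫ ω, rhs ω / ε ω ∂ν ≤ ∫ ω, lhs ω / ε ω ∂ν := by
    refine le_of_forall_lt_imp_le_of_dense fun c' hc' => ?_
    obtain ⟨Z, hZS, hZ⟩ := simons_inequality_of_pos_weights a ha_abs S
      (fun y hy hy1 => by
        obtain ⟨Z, hZS, hZ⟩ := hattain y hy hy1
        refine ⟨Z, hZS, fun X => ?_⟩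
        rw [(hseries y hy1 X).2, (hseries y hy1 Z).2]
        exact hdiv_mono (hseries y hy1 X).1 (hseries y hy1 Z).1 (hZ X))
      (fun y hy hy1 => by
        obtain ⟨Z, -, hZ⟩ := hattain y hy hy1
        refine ⟨Z, ?_⟩
        rw [(hseries y hy1 Z).2]
        exact hdiv_mono hrhs_int (hseries y hy1 Z).1 (hrhs_le y hy hy1 Z hZ))
      hc'
    refine le_integral_of_frequently_le (fun n => (hfmeas n Z).div hεmeas)
      (fun n => hdiv_abs (hfball n Z)) hlhs_int ?_ hZ
    filter_upwards [hac (hlhs.2.1 _ ⟨Z, hZS, rfl⟩), hac (hε_all Z), hac hεpos]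
      with ω h1 h2 h3 b hb
    have hlt : limsup (fun n => f n Z ω) atTop < b * ε ω :=
      h1.trans_lt ((div_lt_iff₀ h3).1 hb)
    exact (eventually_lt_of_limsup_lt hlt
      (isBoundedUnder_of ⟨ε ω, fun n => (abs_le.1 (h2 n)).2⟩)).mono
      fun n hn => (div_lt_iff₀ h3).2 hn
  have hpos : ∀ᵐ ω ∂ν, lhs ω / ε ω < rhs ω / ε ω := by
    filter_upwards [ae_restrict_mem hAmeas, hac hεpos] with ω h1 h2
    exact div_lt_div_of_pos_right h1 h2
  have heq := (integral_eq_iff_of_ae_le hlhs_int hrhs_int (hpos.mono fun _ h => h.le)).1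
    (le_antisymm (integral_mono_ae hlhs_int hrhs_int (hpos.mono fun _ h => h.le)) hint_le)
  have hfalse : ∀ᵐ ω ∂ν, False := by
    filter_upwards [hpos, heq] with ω h1 h2
    exact h1.ne h2
  filter_upwards [(ae_restrict_iff' hAmeas).1 hfalse] with ω hω
  exact not_lt.1 hω
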